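/- Fix real numbers m, a with 0 < |a| < m, set r_± := m ± √(m² − a²) and κ_± := (1/2)(1/m − 1/r_±), and fix θ ∈ ℝ with sin θ ≠ 0. For either sign choice, with r := r_± and ρ² := r² + a²cos²θ, define on ℝ³ (coordinates (X_v, X_θ, X_φ)) the bilinear form g_±(X, Y) := (sin²θ/ρ²)·((r² + a²)X_φ − aX_v)·((r² + a²)Y_φ − aY_v) + ρ²·X_θ·Y_θ and the linear functional ω_±(X) := κ_±·((r² + a²)/ρ²)·(X_v − a sin²θ·X_φ) − (r a sin²θ/ρ⁴)·((r² + a²)X_φ − aX_v) − (a² sin(2θ)/(2ρ²))·X_θ. Then the symmetric bilinear form σ_±(X, Y) := g_±(X, Y) + ω_±(X)·ω_±(Y) is positive definite. -/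

import Mathlib

open Real

/-- The induced lightlike metric `g_±` on the Kerr horizon, on `ℝ³` with coordinates
`(X 0, X 1, X 2) = (X_v, X_θ, X_φ)`. -/
noncomputable def kerrLightlikeForm (a θ r : ℝ) (X Y : Fin 3 → ℝ) : ℝ :=
  (sin θ ^ 2 / (r ^ 2 + a ^ 2 * cos θ ^ 2)) *
      ((r ^ 2 + a ^ 2) * X 2 - a * X 0) * ((r ^ 2 + a ^ 2) * Y 2 - a * Y 0) +
    (r ^ 2 + a ^ 2 * cos θ ^ 2) * X 1 * Y 1

/-- The one-form `ω_±` on the Kerr horizon with surface gravity `κ`. -/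
noncomputable def kerrOmega (a θ r κ : ℝ) (X : Fin 3 → ℝ) : ℝ :=
  κ * ((r ^ 2 + a ^ 2) / (r ^ 2 + a ^ 2 * cos θ ^ 2)) *
      (X 0 - a * sin θ ^ 2 * X 2) -
    (r * a * sin θ ^ 2 / (r ^ 2 + a ^ 2 * cos θ ^ 2) ^ 2) *
      ((r ^ 2 + a ^ 2) * X 2 - a * X 0) -
    (a ^ 2 * sin (2 * θ) / (2 * (r ^ 2 + a ^ 2 * cos θ ^ 2))) * X 1

/-- For `0 < |a| < m`, `sin θ ≠ 0`, and either horizon radius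
`r = r_± = m ± √(m²−a²)` with `κ_± = (1/2)(1/m − 1/r_±)`, the symmetric bilinear
form `σ_± := g_± + ω_± ⊗ ω_±` is positive definite. -/
theorem kerr_induced_metric_posdef (m a : ℝ) (ha : 0 < |a|) (ham : |a| < m)
    (θ : ℝ) (hθ : sin θ ≠ 0) :
    ∀ r ∈ ({m + Real.sqrt (m ^ 2 - a ^ 2), m - Real.sqrt (m ^ 2 - a ^ 2)} : Set ℝ),
      ∀ X : Fin 3 → ℝ, X ≠ 0 →
        0 < kerrLightlikeForm a θ r X X +
            kerrOmega a θ r ((1 / 2) * (1 / m - 1 / r)) X *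
              kerrOmega a θ r ((1 / 2) * (1 / m - 1 / r)) X := by
  intro r hr X hX
  have ha2 : 0 < a ^ 2 := by
    have : a ≠ 0 := abs_pos.mp ha
    positivity
  have hm : 0 < m := ha.trans ham
  have hd : 0 < m ^ 2 - a ^ 2 := by
    have := sq_lt_sq' (by linarith) ham
    rw [sq_abs] at this
    linarith
  have hs : 0 < Real.sqrt (m ^ 2 - a ^ 2) := Real.sqrt_pos.mpr hd
  have hss : Real.sqrt (m ^ 2 - a ^ 2) ^ 2 = m ^ 2 - a ^ 2 := Real.sq_sqrt hd.le
  have hrr : 0 < r ∧ r ≠ m := by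
    rcases hr with h | h
    · subst h
      exact ⟨by linarith, by linarith⟩
    · have h' : r = m - Real.sqrt (m ^ 2 - a ^ 2) := h
      subst h'
      exact ⟨by nlinarith, by linarith⟩
  obtain ⟨hr0, hrm⟩ := hrr
  have hκ : (1 / 2) * (1 / m - 1 / r) ≠ 0 := by
    intro h
    apply hrm
    field_simp at h
    linarith
  generalize (1 / 2) * (1 / m - 1 / r) = κ at hκ ⊢
  have hρ : 0 < r ^ 2 + a ^ 2 * cos θ ^ 2 := by positivity
  by_contra hcon
  apply hX
  have hc : 0 < sin θ ^ 2 / (r ^ 2 + a ^ 2 * cos θ ^ 2) := by positivity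
  have hq : 0 < (r ^ 2 + a ^ 2) / (r ^ 2 + a ^ 2 * cos θ ^ 2) := by positivity
  have e : kerrLightlikeForm a θ r X X =
      (sin θ ^ 2 / (r ^ 2 + a ^ 2 * cos θ ^ 2)) * ((r ^ 2 + a ^ 2) * X 2 - a * X 0) ^ 2 +
      (r ^ 2 + a ^ 2 * cos θ ^ 2) * X 1 ^ 2 := by
    unfold kerrLightlikeForm
    ring
  have n1 := mul_nonneg hc.le (sq_nonneg ((r ^ 2 + a ^ 2) * X 2 - a * X 0))
  have n2 := mul_nonneg hρ.le (sq_nonneg (X 1))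
  have n3 := mul_self_nonneg (kerrOmega a θ r κ X)
  rw [e] at hcon
  have z1 : (r ^ 2 + a ^ 2) * X 2 - a * X 0 = 0 := by
    have h : (sin θ ^ 2 / (r ^ 2 + a ^ 2 * cos θ ^ 2)) *
      ((r ^ 2 + a ^ 2) * X 2 - a * X 0) ^ 2 = 0 := by linarith
    exact pow_eq_zero_iff two_ne_zero |>.mp ((mul_eq_zero.mp h).resolve_left hc.ne')
  have z2 : X 1 = 0 := by
    have h : (r ^ 2 + a ^ 2 * cos θ ^ 2) * X 1 ^ 2 = 0 := by linarith
    exact pow_eq_zero_iff two_ne_zero |>.mp ((mul_eq_zero.mp h).resolve_left hρ.ne')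
  have z3 : kerrOmega a θ r κ X = 0 := mul_self_eq_zero.mp (by linarith)
  unfold kerrOmega at z3
  rw [z1, z2, mul_zero, mul_zero, sub_zero, sub_zero] at z3
  have z4 := (mul_eq_zero.mp z3).resolve_left (mul_ne_zero hκ hq.ne')
  have z5 : (r ^ 2 + a ^ 2 * cos θ ^ 2) * X 2 = 0 := by
    rw [cos_sq']
    linear_combination z1 + a * z4
  have z6 := (mul_eq_zero.mp z5).resolve_left hρ.ne'
  have z7 : X 0 = 0 := by
    rw [z6] at z4
    linarith
  funext i
  fin_cases i
  · exact z7
  · exact z2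
  · exact z6
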